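/- Approximate forbidden intersection theorem. For every D ∈ ℕ there is θ₁ > 0 such that for all κ,ε ∈ (0,θ₁) there is θ₂ > 0 such that for all ζ ∈ (0,θ₂) there exist δ₀ > 0 and n₀ such that for all n ≥ n₀ and δ ∈ (0,δ₀] the following holds. Let R ∈ ℤ^D with all R_d > 0 and suppose: (1) μ_q is a κ-bounded product measure on ({0,1}×{0,1})ⁿ with both marginals equal to μ_p; (2) 𝒱 = (v_i : i∈[n]) is an R-bounded family of vectors in ℤ^D; (3) 𝒱_∩(μ_q) = w ∈ ℝ^D, and L = {w' ∈ ℤ^D : ‖w − w'‖_R ≤ ζn}. Then every 𝒜 ⊆ {0,1}ⁿ with μ_p(𝒜) > (1−δ)ⁿ satisfies μ_q((𝒜 × 𝒜)^{𝒱_∩}_L) > (1−ε)ⁿ, where (𝒜×𝒜)^{𝒱_∩}_L = {(A,B) ∈ 𝒜×𝒜 : 𝒱_∩(A,B) ∈ L}. -/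

import Mathlib

open Finset

noncomputable section

/-- The `R`-scaled sup-norm `max_d |v d| / R d`. -/
noncomputable def rnorm {D : ℕ} (R : Fin D → ℝ) (v : Fin D → ℝ) : ℝ :=
  ⨆ d, |v d| / R d

/-- Product measure on `Jⁿ` from weights `p`. -/
def prodMeas {n : ℕ} {J : Type*} (p : Fin n → J → ℝ) (a : Fin n → J) : ℝ :=
  ∏ i, p i (a i)

/-- Measure of a set under a (finitely supported) measure `μ`. -/
noncomputable def smeas {α : Type*} [Fintype α] (μ : α → ℝ) (A : Set α) : ℝ :=
  ∑ x, A.indicator μ x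

/-- The array `𝒱_∩` associated to a family of vectors `v`. -/
def capArr {n D : ℕ} (v : Fin n → Fin D → ℤ) (i : Fin n) (jj : Bool × Bool) (d : Fin D) : ℤ :=
  if jj.1 ∧ jj.2 then v i d else 0

/-- Evaluation of an `(n,J)`-array at `a ∈ Jⁿ`. -/
def arrEval {n D : ℕ} {J : Type*} (V : Fin n → J → Fin D → ℤ)
    (a : Fin n → J) (d : Fin D) : ℤ :=
  ∑ i, V i (a i) d

/-- Expectation `𝒱(μ) d = E_{a∼μ} 𝒱(a) d`. -/
noncomputable def arrExp {n D : ℕ} {J : Type*} [Fintype J]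
    (V : Fin n → J → Fin D → ℤ) (μ : (Fin n → J) → ℝ) (d : Fin D) : ℝ :=
  ∑ a : Fin n → J, μ a * (arrEval V a d : ℝ)

lemma one_sub_mul_div_pow_le {κ : ℝ} (hκ : 0 < κ) {C : ℕ} (hC : 0 < C)
    (h : κ * (1 / κ ^ 2 / C) ≤ 1) : (1 - κ * (1 / κ ^ 2 / C)) ^ C ≤ κ := by
  have hCpos : (0 : ℝ) < C := by exact_mod_cast hC
  calc (1 - κ * (1 / κ ^ 2 / C)) ^ C ≤ (Real.exp (-(κ * (1 / κ ^ 2 / C)))) ^ C :=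
        pow_le_pow_left₀ (by linarith) (Real.one_sub_le_exp_neg _) _
    _ = Real.exp (-κ⁻¹) := by
        rw [← Real.exp_nat_mul]
        congr 1
        field_simp
    _ ≤ κ := by
        rw [Real.exp_neg]
        refine inv_le_of_inv_le₀ hκ ?_
        linarith [Real.add_one_le_exp κ⁻¹]

/-- If two functions on a two-point space are nearly constant, then the mean of their product
is nearly the product of their means. -/
lemma mul_mean_le_mean_mul {q₀₀ q₀₁ q₁₀ q₁₁ a₀ a₁ b₀ b₁ c : ℝ}
    (h₀₀ : 0 ≤ q₀₀) (h₀₁ : 0 ≤ q₀₁) (h₁₀ : 0 ≤ q₁₀) (h₁₁ : 0 ≤ q₁₁)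
    (hq : q₀₀ + q₀₁ + q₁₀ + q₁₁ = 1) (hc : 0 ≤ c) (hc2 : 2 * c ≤ 1)
    (ha₀ : 0 ≤ a₀) (hb₀ : 0 ≤ b₀) (ha : a₁ ≤ a₀) (hb : b₁ ≤ b₀)
    (hs : a₀ - a₁ ≤ c * a₀) (ht : b₀ - b₁ ≤ c * b₀) :
    ((q₀₀ + q₀₁) * a₀ + (q₁₀ + q₁₁) * a₁) * ((q₀₀ + q₁₀) * b₀ + (q₀₁ + q₁₁) * b₁) *
        (1 - 4 * c ^ 2) ≤
      q₀₀ * (a₀ * b₀) + q₀₁ * (a₀ * b₁) + q₁₀ * (a₁ * b₀) + q₁₁ * (a₁ * b₁) := by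
  obtain ⟨x, hx⟩ : ∃ x, x = (q₀₀ + q₀₁) * a₀ + (q₁₀ + q₁₁) * a₁ := ⟨_, rfl⟩
  obtain ⟨y, hy⟩ : ∃ y, y = (q₀₀ + q₁₀) * b₀ + (q₀₁ + q₁₁) * b₁ := ⟨_, rfl⟩
  have hcov : q₀₀ * (a₀ * b₀) + q₀₁ * (a₀ * b₁) + q₁₀ * (a₁ * b₀) + q₁₁ * (a₁ * b₁) =
      x * y + (q₀₀ * q₁₁ - q₀₁ * q₁₀) * ((a₀ - a₁) * (b₀ - b₁)) := by
    rw [hx, hy]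
    have : q₀₀ = 1 - q₀₁ - q₁₀ - q₁₁ := by linarith
    rw [this]; ring
  rw [hcov, ← hx, ← hy]
  have hxa : a₀ ≤ 2 * x := by
    have h1 : (q₁₀ + q₁₁) * (a₀ - a₁) ≤ 1 * (a₀ - a₁) :=
      mul_le_mul_of_nonneg_right (by linarith) (by linarith)
    have h2 : x = a₀ - (q₁₀ + q₁₁) * (a₀ - a₁) := by rw [hx]; linear_combination a₀ * hq
    have h3 : 2 * c * a₀ ≤ 1 * a₀ := mul_le_mul_of_nonneg_right hc2 ha₀
    linarith
  have hyb : b₀ ≤ 2 * y := by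
    have h1 : (q₀₁ + q₁₁) * (b₀ - b₁) ≤ 1 * (b₀ - b₁) :=
      mul_le_mul_of_nonneg_right (by linarith) (by linarith)
    have h2 : y = b₀ - (q₀₁ + q₁₁) * (b₀ - b₁) := by rw [hy]; linear_combination b₀ * hq
    have h3 : 2 * c * b₀ ≤ 1 * b₀ := mul_le_mul_of_nonneg_right hc2 hb₀
    linarith
  have hst : (a₀ - a₁) * (b₀ - b₁) ≤ (c * (2 * x)) * (c * (2 * y)) :=
    mul_le_mul (hs.trans (mul_le_mul_of_nonneg_left hxa hc))
      (ht.trans (mul_le_mul_of_nonneg_left hyb hc)) (by linarith)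
      (mul_nonneg hc (by linarith))
  have hdet : -1 ≤ q₀₀ * q₁₁ - q₀₁ * q₁₀ := by
    have h1 : q₀₁ * q₁₀ ≤ 1 * 1 := mul_le_mul (by linarith) (by linarith) h₁₀ zero_le_one
    have h2 : 0 ≤ q₀₀ * q₁₁ := mul_nonneg h₀₀ h₁₁
    linarith
  have hst0 : 0 ≤ (a₀ - a₁) * (b₀ - b₁) := mul_nonneg (by linarith) (by linarith)
  have h := mul_le_mul_of_nonneg_right hdet hst0
  linarith

/-- A two-point reverse Hölder inequality with loss, with both functions maximal at the point
carrying the weight `q₀₀`. -/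
lemma two_point_ordered {κ η : ℝ} (hκ : 0 < κ) (hη : 0 < η) {C : ℕ}
    (hC : 2 * (1 / κ ^ 2) ≤ C) (hC' : 4 * (1 / κ ^ 2) ^ 2 ≤ η * C)
    {q₀₀ q₀₁ q₁₀ q₁₁ a₀ a₁ b₀ b₁ : ℝ}
    (h₀₀ : κ ≤ q₀₀) (h₀₁ : κ ≤ q₀₁) (h₁₀ : κ ≤ q₁₀) (h₁₁ : κ ≤ q₁₁)
    (hq : q₀₀ + q₀₁ + q₁₀ + q₁₁ = 1)
    (ha₁ : 0 ≤ a₁) (hb₁ : 0 ≤ b₁) (ha : a₁ ≤ a₀) (hb : b₁ ≤ b₀) :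
    (1 - η) * (((q₀₀ + q₀₁) * a₀ + (q₁₀ + q₁₁) * a₁) ^ C *
        ((q₀₀ + q₁₀) * b₀ + (q₀₁ + q₁₁) * b₁) ^ C) ≤
      q₀₀ * (a₀ ^ C * b₀ ^ C) + q₀₁ * (a₀ ^ C * b₁ ^ C) + q₁₀ * (a₁ ^ C * b₀ ^ C) +
        q₁₁ * (a₁ ^ C * b₁ ^ C) := by
  have ha₀ : 0 ≤ a₀ := ha₁.trans ha
  have hb₀ : 0 ≤ b₀ := hb₁.trans hb
  have p₀₀ : 0 ≤ q₀₀ := hκ.le.trans h₀₀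
  have p₀₁ : 0 ≤ q₀₁ := hκ.le.trans h₀₁
  have p₁₀ : 0 ≤ q₁₀ := hκ.le.trans h₁₀
  have p₁₁ : 0 ≤ q₁₁ := hκ.le.trans h₁₁
  have hCpos : (0 : ℝ) < C := lt_of_lt_of_le (by positivity) hC
  obtain ⟨c, hc⟩ : ∃ c : ℝ, c = 1 / κ ^ 2 / C := ⟨_, rfl⟩
  have hcpos : 0 < c := by rw [hc]; positivity
  have hc2 : 2 * c ≤ 1 := by
    rw [hc, mul_div_assoc', div_le_one hCpos]; exact hC
  have hkc : κ * c ≤ 1 := by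
    have : κ * c ≤ 1 * c := mul_le_mul_of_nonneg_right (by linarith) hcpos.le
    linarith
  have hsmall : (1 - κ * c) ^ C ≤ κ := by
    rw [hc] at hkc ⊢
    exact one_sub_mul_div_pow_le hκ (by exact_mod_cast hCpos) hkc
  have hmean := mul_mean_le_mean_mul p₀₀ p₀₁ p₁₀ p₁₁ hq hcpos.le hc2 ha₀ hb₀ ha hb
  obtain ⟨x, hx⟩ : ∃ x, x = (q₀₀ + q₀₁) * a₀ + (q₁₀ + q₁₁) * a₁ := ⟨_, rfl⟩
  obtain ⟨y, hy⟩ : ∃ y, y = (q₀₀ + q₁₀) * b₀ + (q₀₁ + q₁₁) * b₁ := ⟨_, rfl⟩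
  rw [← hx, ← hy] at hmean ⊢
  have hx0 : 0 ≤ x := by rw [hx]; positivity
  have hy0 : 0 ≤ y := by rw [hy]; positivity
  have hxs : x ≤ a₀ - κ * (a₀ - a₁) := by
    have h1 : x = a₀ - (q₁₀ + q₁₁) * (a₀ - a₁) := by rw [hx]; linear_combination a₀ * hq
    have h2 : κ * (a₀ - a₁) ≤ (q₁₀ + q₁₁) * (a₀ - a₁) :=
      mul_le_mul_of_nonneg_right (by linarith) (by linarith)
    linarith
  have hys : y ≤ b₀ - κ * (b₀ - b₁) := by
    have h1 : y = b₀ - (q₀₁ + q₁₁) * (b₀ - b₁) := by rw [hy]; linear_combination b₀ * hq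
    have h2 : κ * (b₀ - b₁) ≤ (q₀₁ + q₁₁) * (b₀ - b₁) :=
      mul_le_mul_of_nonneg_right (by linarith) (by linarith)
    linarith
  have hxa : x ≤ a₀ := hxs.trans (sub_le_self _ (mul_nonneg hκ.le (by linarith)))
  have hyb : y ≤ b₀ := hys.trans (sub_le_self _ (mul_nonneg hκ.le (by linarith)))
  have hdecay : ∀ u u₀ s : ℝ, 0 ≤ u → 0 ≤ u₀ → u ≤ u₀ - κ * s → c * u₀ < s →
      u ^ C ≤ κ * u₀ ^ C := fun u u₀ s hu hu₀ hus hs ↦ by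
    have h1 : u ≤ u₀ * (1 - κ * c) := by
      have := mul_le_mul_of_nonneg_left hs.le hκ.le
      linarith
    calc u ^ C ≤ (u₀ * (1 - κ * c)) ^ C := pow_le_pow_left₀ hu h1 _
      _ = u₀ ^ C * (1 - κ * c) ^ C := mul_pow _ _ _
      _ ≤ u₀ ^ C * κ := mul_le_mul_of_nonneg_left hsmall (pow_nonneg hu₀ _)
      _ = κ * u₀ ^ C := mul_comm _ _
  have hmain : κ * (a₀ ^ C * b₀ ^ C) ≤
      q₀₀ * (a₀ ^ C * b₀ ^ C) + q₀₁ * (a₀ ^ C * b₁ ^ C) + q₁₀ * (a₁ ^ C * b₀ ^ C) +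
        q₁₁ * (a₁ ^ C * b₁ ^ C) := by
    have h1 : κ * (a₀ ^ C * b₀ ^ C) ≤ q₀₀ * (a₀ ^ C * b₀ ^ C) :=
      mul_le_mul_of_nonneg_right h₀₀ (by positivity)
    have h2 : 0 ≤ q₀₁ * (a₀ ^ C * b₁ ^ C) := by positivity
    have h3 : 0 ≤ q₁₀ * (a₁ ^ C * b₀ ^ C) := by positivity
    have h4 : 0 ≤ q₁₁ * (a₁ ^ C * b₁ ^ C) := by positivity
    linarith
  have hη1 : (1 - η) * (x ^ C * y ^ C) ≤ x ^ C * y ^ C :=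
    mul_le_of_le_one_left (by positivity) (by linarith)
  rcases lt_or_ge (c * a₀) (a₀ - a₁) with hs | hs
  · refine (hη1.trans ?_).trans hmain
    calc x ^ C * y ^ C ≤ (κ * a₀ ^ C) * b₀ ^ C :=
          mul_le_mul (hdecay x a₀ _ hx0 ha₀ hxs hs) (pow_le_pow_left₀ hy0 hyb _)
            (by positivity) (by positivity)
      _ = _ := by ring
  rcases lt_or_ge (c * b₀) (b₀ - b₁) with ht | ht
  · refine (hη1.trans ?_).trans hmain
    calc x ^ C * y ^ C ≤ a₀ ^ C * (κ * b₀ ^ C) :=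
          mul_le_mul (pow_le_pow_left₀ hx0 hxa _) (hdecay y b₀ _ hy0 hb₀ hys ht)
            (by positivity) (by positivity)
      _ = _ := by ring
  have hjensen : (q₀₀ * (a₀ * b₀) + q₀₁ * (a₀ * b₁) + q₁₀ * (a₁ * b₀) + q₁₁ * (a₁ * b₁)) ^ C ≤
      q₀₀ * (a₀ ^ C * b₀ ^ C) + q₀₁ * (a₀ ^ C * b₁ ^ C) + q₁₀ * (a₁ ^ C * b₀ ^ C) +
        q₁₁ * (a₁ ^ C * b₁ ^ C) := by
    have := Real.pow_arith_mean_le_arith_mean_pow univ ![q₀₀, q₀₁, q₁₀, q₁₁]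
      ![a₀ * b₀, a₀ * b₁, a₁ * b₀, a₁ * b₁]
      (by simp [Fin.forall_fin_succ, p₀₀, p₀₁, p₁₀, p₁₁])
      (by simp [Fin.sum_univ_four, hq])
      (by simp [Fin.forall_fin_succ, mul_nonneg, ha₀, hb₀, ha₁, hb₁]) C
    simpa [Fin.sum_univ_four, mul_pow] using this
  have hc4 : 0 ≤ 1 - 4 * c ^ 2 := by nlinarith only [hc2, hcpos]
  have hb := one_add_mul_le_pow (a := -(4 * c ^ 2)) (by linarith) C
  have h5 : (C : ℝ) * (4 * c ^ 2) ≤ η := by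
    have h6 : (C : ℝ) * (4 * c ^ 2) = 4 * (1 / κ ^ 2) ^ 2 / C := by rw [hc]; field_simp
    rw [h6, div_le_iff₀ hCpos]; exact hC'
  rw [← sub_eq_add_neg] at hb
  calc (1 - η) * (x ^ C * y ^ C) ≤ (1 - 4 * c ^ 2) ^ C * (x ^ C * y ^ C) :=
        mul_le_mul_of_nonneg_right (by linarith) (by positivity)
    _ = (x * y * (1 - 4 * c ^ 2)) ^ C := by rw [mul_pow, mul_pow]; ring
    _ ≤ _ := (pow_le_pow_left₀ (by positivity) (hmean hs ht) _).trans hjensen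

/-- A two-point reverse Hölder inequality with loss. -/
lemma two_point {κ η : ℝ} (hκ : 0 < κ) (hη : 0 < η) :
    ∃ C : ℕ, C ≠ 0 ∧ ∀ q : Bool × Bool → ℝ, (∀ jj, κ ≤ q jj) → ∑ jj, q jj = 1 →
      ∀ a b : Bool → ℝ, (∀ j, 0 ≤ a j) → (∀ j, 0 ≤ b j) →
      (1 - η) * ((∑ j, (∑ j', q (j, j')) * a j) ^ C * (∑ j, (∑ j', q (j', j)) * b j) ^ C) ≤
        ∑ jj : Bool × Bool, q jj * (a jj.1 ^ C * b jj.2 ^ C) := by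
  obtain ⟨C, hC⟩ := exists_nat_ge (max (2 * (1 / κ ^ 2)) (4 * (1 / κ ^ 2) ^ 2 / η))
  have hC1 := (le_max_left _ _).trans hC
  have hC2 : 4 * (1 / κ ^ 2) ^ 2 ≤ η * C := by
    have := (le_max_right _ _).trans hC
    rw [div_le_iff₀ hη] at this
    linarith
  refine ⟨C, ?_, fun q hκq hq a b ha hb ↦ ?_⟩
  · rintro rfl
    have : 0 < 2 * (1 / κ ^ 2) := by positivity
    rw [Nat.cast_zero] at hC1
    linarith
  simp only [Fintype.sum_prod_type, Fintype.sum_bool] at hq ⊢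
  rcases le_total (a true) (a false) with h | h <;> rcases le_total (b true) (b false) with h' | h'
  · have := two_point_ordered hκ hη hC1 hC2 (hκq (false, false)) (hκq (false, true))
      (hκq (true, false)) (hκq (true, true)) (by linarith) (ha _) (hb _) h h'
    convert this using 1 <;> ring
  · have := two_point_ordered hκ hη hC1 hC2 (hκq (false, true)) (hκq (false, false))
      (hκq (true, true)) (hκq (true, false)) (by linarith) (ha _) (hb _) h h'
    convert this using 1 <;> ring
  · have := two_point_ordered hκ hη hC1 hC2 (hκq (true, false)) (hκq (true, true))
      (hκq (false, false)) (hκq (false, true)) (by linarith) (ha _) (hb _) h h'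
    convert this using 1 <;> ring
  · have := two_point_ordered hκ hη hC1 hC2 (hκq (true, true)) (hκq (true, false))
      (hκq (false, true)) (hκq (false, false)) (by linarith) (ha _) (hb _) h h'
    convert this using 1; ring

lemma smeas_nonneg {α : Type*} [Fintype α] {μ : α → ℝ} (hμ : ∀ x, 0 ≤ μ x) (A : Set α) :
    0 ≤ smeas μ A :=
  sum_nonneg fun _ _ ↦ Set.indicator_nonneg (fun x _ ↦ hμ x) _

lemma prodMeas_nonneg {n : ℕ} {J : Type*} {p : Fin n → J → ℝ} (hp : ∀ i j, 0 ≤ p i j)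
    (a : Fin n → J) : 0 ≤ prodMeas p a :=
  prod_nonneg fun i _ ↦ hp i (a i)

/-- Conditioning a product measure on the first coordinate. -/
lemma smeas_prodMeas_succ {n : ℕ} {J : Type*} [Fintype J] (p : Fin (n + 1) → J → ℝ)
    (A : Set (Fin (n + 1) → J)) :
    smeas (prodMeas p) A =
      ∑ j, p 0 j * smeas (prodMeas fun i ↦ p i.succ) {x | Fin.cons j x ∈ A} := by
  classical
  unfold smeas prodMeas
  rw [← (Fin.consEquiv fun _ ↦ J).sum_comp, Fintype.sum_prod_type]
  refine sum_congr rfl fun j _ ↦ ?_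
  rw [mul_sum]
  refine sum_congr rfl fun x _ ↦ ?_
  simp [Set.indicator_apply, Fin.consEquiv, Fin.prod_univ_succ]

/-- Tensorization of the two-point inequality: correlated spaces mix all sets of non-negligible
measure, up to an arbitrarily small exponential loss. -/
lemma smeas_prod_lower_bound {κ η : ℝ} {C : ℕ} (hκ : 0 < κ) (hη : η < 1) (hC : C ≠ 0)
    (htwo : ∀ q : Bool × Bool → ℝ, (∀ jj, κ ≤ q jj) → ∑ jj, q jj = 1 →
      ∀ a b : Bool → ℝ, (∀ j, 0 ≤ a j) → (∀ j, 0 ≤ b j) →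
      (1 - η) * ((∑ j, (∑ j', q (j, j')) * a j) ^ C * (∑ j, (∑ j', q (j', j)) * b j) ^ C) ≤
        ∑ jj : Bool × Bool, q jj * (a jj.1 ^ C * b jj.2 ^ C))
    {n : ℕ} (q : Fin n → Bool × Bool → ℝ) (hq : ∀ i jj, κ ≤ q i jj)
    (hq1 : ∀ i, ∑ jj, q i jj = 1) (A B : Set (Fin n → Bool)) :
    (1 - η) ^ n * (smeas (prodMeas fun i j ↦ ∑ j', q i (j, j')) A ^ C *
        smeas (prodMeas fun i j ↦ ∑ j', q i (j', j)) B ^ C) ≤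
      smeas (prodMeas q) {r | (fun i ↦ (r i).1) ∈ A ∧ (fun i ↦ (r i).2) ∈ B} := by
  induction n with
  | zero =>
    rcases A.eq_empty_or_nonempty with rfl | hA
    · simp [smeas, hC]
    rcases B.eq_empty_or_nonempty with rfl | hB
    · simp [smeas, hC]
    rw [Subsingleton.eq_univ_of_nonempty hA, Subsingleton.eq_univ_of_nonempty hB]
    simp [smeas, prodMeas]
  | succ n ih =>
    have hq0 : ∀ i jj, 0 ≤ q i jj := fun i jj ↦ hκ.le.trans (hq i jj)
    rw [smeas_prodMeas_succ q, smeas_prodMeas_succ, smeas_prodMeas_succ]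
    have h := htwo (q 0) (hq 0) (hq1 0)
      (fun j ↦ smeas (prodMeas fun i j ↦ ∑ j', q (Fin.succ i) (j, j')) {x | Fin.cons j x ∈ A})
      (fun j ↦ smeas (prodMeas fun i j ↦ ∑ j', q (Fin.succ i) (j', j)) {x | Fin.cons j x ∈ B})
      (fun j ↦ smeas_nonneg (prodMeas_nonneg fun i j ↦ sum_nonneg fun _ _ ↦ hq0 _ _) _)
      (fun j ↦ smeas_nonneg (prodMeas_nonneg fun i j ↦ sum_nonneg fun _ _ ↦ hq0 _ _) _)
    rw [pow_succ, mul_assoc]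
    refine (mul_le_mul_of_nonneg_left h (pow_nonneg (by linarith) n)).trans ?_
    rw [mul_sum]
    refine sum_le_sum fun jj _ ↦ ?_
    rw [mul_left_comm]
    refine mul_le_mul_of_nonneg_left ?_ (hq0 _ _)
    refine (ih (fun i ↦ q i.succ) (fun i ↦ hq _) (fun i ↦ hq1 _) _ _).trans (le_of_eq ?_)
    congr 1
    ext r
    have h1 : (fun i ↦ ((Fin.cons jj r : Fin (n + 1) → Bool × Bool) i).1) =
        Fin.cons jj.1 fun i ↦ (r i).1 := by
      ext i; refine Fin.cases ?_ (fun i ↦ ?_) i <;> simp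
    have h2 : (fun i ↦ ((Fin.cons jj r : Fin (n + 1) → Bool × Bool) i).2) =
        Fin.cons jj.2 fun i ↦ (r i).2 := by
      ext i; refine Fin.cases ?_ (fun i ↦ ?_) i <;> simp
    simp only [Set.mem_ofPred_eq, h1, h2]

lemma sum_prodMeas_eq_prod {n : ℕ} {J : Type*} [Fintype J] (g : Fin n → J → ℝ) :
    ∑ a : Fin n → J, ∏ i, g i (a i) = ∏ i, ∑ j, g i j := by
  classical
  rw [prod_univ_sum, Fintype.piFinset_univ]

lemma arrExp_prodMeas {n D : ℕ} {J : Type*} [Fintype J] {q : Fin n → J → ℝ}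
    (hq1 : ∀ i, ∑ j, q i j = 1) (V : Fin n → J → Fin D → ℤ) (d : Fin D) :
    arrExp V (prodMeas q) d = ∑ i, ∑ j, q i j * (V i j d : ℝ) := by
  classical
  unfold arrExp arrEval
  push_cast
  simp only [mul_sum]
  rw [sum_comm]
  refine sum_congr rfl fun i _ ↦ ?_
  have h1 : ∀ a : Fin n → J, prodMeas q a * (V i (a i) d : ℝ) =
      ∏ k, q k (a k) * (if k = i then (V k (a k) d : ℝ) else 1) := fun a ↦ by
    rw [prod_mul_distrib, prod_ite_eq' univ i fun k ↦ (V k (a k) d : ℝ)]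
    simp [prodMeas]
  simp only [h1]
  rw [sum_prodMeas_eq_prod fun k j ↦ q k j * (if k = i then (V k j d : ℝ) else 1),
    prod_eq_single i]
  · simp
  · intro k _ hk
    simp [hk, hq1]
  · simp

/-- Chernoff bound for sums of independent centred variables bounded by `1`. -/
lemma smeas_chernoff {n : ℕ} {J : Type*} [Fintype J] {q : Fin n → J → ℝ}
    (hq : ∀ i j, 0 ≤ q i j) (hq1 : ∀ i, ∑ j, q i j = 1) {W : Fin n → J → ℝ}
    (hW : ∀ i j, |W i j| ≤ 1) (hW0 : ∀ i, ∑ j, q i j * W i j = 0) {ζ : ℝ} (hζ : 0 < ζ)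
    (hζ1 : ζ ≤ 1) :
    smeas (prodMeas q) {a | ζ * n < ∑ i, W i (a i)} ≤ Real.exp (-(ζ ^ 2 / 4)) ^ n := by
  classical
  have hfac : ∀ i, ∑ j, q i j * Real.exp (ζ / 2 * W i j) ≤ Real.exp (ζ ^ 2 / 4) := fun i ↦ by
    have h1 : ∀ j, Real.exp (ζ / 2 * W i j) ≤ 1 + ζ / 2 * W i j + ζ ^ 2 / 4 := fun j ↦ by
      have hb := abs_le.1 (hW i j)
      have hle : |ζ / 2 * W i j| ≤ 1 := by
        rw [abs_mul, abs_of_pos (by positivity : 0 < ζ / 2)]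
        nlinarith [hW i j, abs_nonneg (W i j)]
      have h2 := (abs_le.1 (Real.abs_exp_sub_one_sub_id_le hle)).2
      have h3 : (W i j) ^ 2 ≤ 1 := by nlinarith
      nlinarith [sq_nonneg ζ]
    calc ∑ j, q i j * Real.exp (ζ / 2 * W i j)
        ≤ ∑ j, q i j * (1 + ζ / 2 * W i j + ζ ^ 2 / 4) :=
          sum_le_sum fun j _ ↦ mul_le_mul_of_nonneg_left (h1 j) (hq i j)
      _ = (1 + ζ ^ 2 / 4) * ∑ j, q i j + ζ / 2 * ∑ j, q i j * W i j := by
          rw [mul_sum, mul_sum, ← sum_add_distrib]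
          exact sum_congr rfl fun j _ ↦ by ring
      _ = ζ ^ 2 / 4 + 1 := by rw [hq1, hW0]; ring
      _ ≤ _ := Real.add_one_le_exp _
  calc smeas (prodMeas q) {a | ζ * n < ∑ i, W i (a i)}
      ≤ ∑ a : Fin n → J, Real.exp (-(ζ / 2 * (ζ * n))) *
          ∏ i, q i (a i) * Real.exp (ζ / 2 * W i (a i)) := by
        refine sum_le_sum fun a _ ↦ ?_
        have hP : 0 ≤ prodMeas q a := prodMeas_nonneg hq a
        rw [prod_mul_distrib, ← Real.exp_sum, ← mul_sum, mul_left_comm, ← Real.exp_add]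
        refine Set.indicator_apply_le' (fun ha ↦ ?_) (fun _ ↦ ?_)
        · refine le_mul_of_one_le_right hP (Real.one_le_exp ?_)
          have : ζ * n < ∑ i, W i (a i) := ha
          nlinarith
        · exact mul_nonneg hP (Real.exp_pos _).le
    _ = Real.exp (-(ζ / 2 * (ζ * n))) * ∏ i, ∑ j, q i j * Real.exp (ζ / 2 * W i j) := by
        rw [← mul_sum, sum_prodMeas_eq_prod fun i j ↦ q i j * Real.exp (ζ / 2 * W i j)]
    _ ≤ Real.exp (-(ζ / 2 * (ζ * n))) * ∏ _i : Fin n, Real.exp (ζ ^ 2 / 4) := by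
        gcongr with i
        · intro i _
          exact sum_nonneg fun j _ ↦ mul_nonneg (hq i j) (Real.exp_pos _).le
        · exact hfac i
    _ = Real.exp (-(ζ ^ 2 / 4)) ^ n := by
        rw [prod_const, card_univ, Fintype.card_fin, ← Real.exp_nat_mul, ← Real.exp_nat_mul,
          ← Real.exp_add]
        congr 1; ring

lemma smeas_le_add_sum {α ι : Type*} [Fintype α] [Fintype ι] {μ : α → ℝ} (hμ : ∀ x, 0 ≤ μ x)
    {A B : Set α} {S : ι → Set α} (h : ∀ x ∈ A, x ∈ B ∨ ∃ i, x ∈ S i) :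
    smeas μ A ≤ smeas μ B + ∑ i, smeas μ (S i) := by
  unfold smeas
  rw [sum_comm, ← sum_add_distrib]
  refine sum_le_sum fun x _ ↦ ?_
  have hnn : ∀ T : Set α, 0 ≤ T.indicator μ x := fun T ↦ Set.indicator_nonneg (fun y _ ↦ hμ y) x
  refine Set.indicator_apply_le' (fun hx ↦ ?_)
    (fun _ ↦ add_nonneg (hnn _) (sum_nonneg fun i _ ↦ hnn _))
  rcases h x hx with hB | ⟨i, hi⟩
  · rw [Set.indicator_of_mem hB]
    exact le_add_of_nonneg_right (sum_nonneg fun i _ ↦ hnn _)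
  · have := single_le_sum (f := fun i ↦ (S i).indicator μ x) (fun i _ ↦ hnn (S i)) (mem_univ i)
    simp only [Set.indicator_of_mem hi] at this
    exact this.trans (le_add_of_nonneg_left (hnn _))

lemma rnorm_le_iff {D : ℕ} {R v : Fin D → ℝ} {c : ℝ} (hc : 0 ≤ c) :
    rnorm R v ≤ c ↔ ∀ d, |v d| / R d ≤ c :=
  ⟨fun h d ↦ (le_ciSup (f := fun d ↦ |v d| / R d) (Set.finite_range _).bddAbove d).trans h,
    fun h ↦ Real.iSup_le h hc⟩

/-- **Approximate forbidden intersection theorem.**  Here `w = 𝒱_∩(μ_q) ∈ ℝ^D`, and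
`(𝒜×𝒜)^{𝒱_∩}_L` with `L = {w' ∈ ℤ^D : ‖w − w'‖_R ≤ ζn}` is expressed as the set of
pair sequences `r` with both coordinate projections in `𝒜` and
`‖𝒱_∩(r) − w‖_R ≤ ζn`. -/
theorem approximate_forbidden_intersections (D : ℕ) :
    ∃ θ₁ > (0:ℝ), ∀ κ ∈ Set.Ioo (0:ℝ) θ₁, ∀ ε ∈ Set.Ioo (0:ℝ) θ₁,
    ∃ θ₂ > (0:ℝ), ∀ ζ ∈ Set.Ioo (0:ℝ) θ₂,
    ∃ δ₀ > (0:ℝ), ∃ n₀ : ℕ, ∀ n, n₀ ≤ n → ∀ δ ∈ Set.Ioc (0:ℝ) δ₀,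
    ∀ R : Fin D → ℤ, (∀ d, 0 < R d) →
    ∀ q : Fin n → Bool × Bool → ℝ,
      (∀ i, ∑ jj : Bool × Bool, q i jj = 1) →
      (∀ i jj, q i jj ∈ Set.Icc κ (1 - κ)) →
    ∀ p : Fin n → Bool → ℝ,
      (∀ i j, ∑ j' : Bool, q i (j, j') = p i j) →
      (∀ i j, ∑ j' : Bool, q i (j', j) = p i j) →
    ∀ v : Fin n → Fin D → ℤ,
      (∀ i, rnorm (fun d => (R d : ℝ)) (fun d => (v i d : ℝ)) ≤ 1) →
    ∀ A : Set (Fin n → Bool),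
      (1 - δ) ^ n < smeas (prodMeas p) A →
      (1 - ε) ^ n <
        smeas (prodMeas q)
          {r : Fin n → Bool × Bool | (fun i => (r i).1) ∈ A ∧ (fun i => (r i).2) ∈ A ∧
            rnorm (fun d => (R d : ℝ))
              (fun d => (arrEval (capArr v) r d : ℝ) - arrExp (capArr v) (prodMeas q) d)
              ≤ ζ * n} := by
  refine ⟨1, one_pos, fun κ hκ ε hε ↦ ⟨1, one_pos, fun ζ hζ ↦ ?_⟩⟩
  obtain ⟨hκ0, -⟩ := hκ
  obtain ⟨hε0, hε1⟩ := hε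
  obtain ⟨hζ0, hζ1⟩ := hζ
  obtain ⟨β, hβ⟩ : ∃ β, β = max (1 - ε) (Real.exp (-(ζ ^ 2 / 4))) := ⟨_, rfl⟩
  have hβε : 1 - ε ≤ β := hβ ▸ le_max_left _ _
  have hβζ : Real.exp (-(ζ ^ 2 / 4)) ≤ β := hβ ▸ le_max_right _ _
  have hβ0 : 0 < β := by linarith
  have hβ1 : β < 1 := by
    rw [hβ]
    refine max_lt (by linarith) (Real.exp_lt_one_iff.2 ?_)
    have : 0 < ζ ^ 2 := by positivity
    linarith
  have hη : 0 < (1 - β) / 4 := by linarith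
  obtain ⟨C, hC0, htwo⟩ := two_point hκ0 hη
  have hCpos : (0 : ℝ) < C := by exact_mod_cast Nat.pos_of_ne_zero hC0
  obtain ⟨ρ, hρ⟩ : ∃ ρ, ρ = (1 + β) / 2 := ⟨_, rfl⟩
  have hρβ : 1 < ρ / β := by rw [one_lt_div hβ0]; linarith
  obtain ⟨n₀, hn₀⟩ := ((tendsto_pow_atTop_atTop_of_one_lt hρβ).eventually_gt_atTop
    (2 * D + 1 : ℝ)).exists_forall_of_atTop
  refine ⟨min 1 ((1 - β) / (8 * C)), lt_min one_pos (div_pos (by linarith) (by positivity)), n₀,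
    fun n hn δ hδ R hR q hq1 hq p hp hp' v hv A hA ↦ ?_⟩
  have hδ1 : δ ≤ 1 := hδ.2.trans (min_le_left _ _)
  have hδC : 2 * C * δ ≤ (1 - β) / 4 := by
    have := hδ.2.trans (min_le_right _ _)
    rw [le_div_iff₀ (by positivity)] at this
    linarith
  have hq0 : ∀ i jj, 0 ≤ q i jj := fun i jj ↦ hκ0.le.trans (hq i jj).1
  have hRpos : ∀ d, (0 : ℝ) < R d := fun d ↦ by exact_mod_cast hR d
  have hmix := smeas_prod_lower_bound hκ0 (by linarith) hC0 htwo q (fun i jj ↦ (hq i jj).1)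
    hq1 A A
  simp only [hp, hp'] at hmix
  let W : Fin D → Fin n → Bool × Bool → ℝ := fun d i jj ↦
    (capArr v i jj d - ∑ kk, q i kk * (capArr v i kk d : ℝ)) / R d
  have hv' : ∀ i d, |(v i d : ℝ)| ≤ R d := fun i d ↦ by
    have := (rnorm_le_iff zero_le_one).1 (hv i) d
    rwa [div_le_one (hRpos d)] at this
  have hmeanq : ∀ i d, ∑ kk, q i kk * (capArr v i kk d : ℝ) = q i (true, true) * v i d :=
    fun i d ↦ by simp [Fintype.sum_prod_type, capArr]
  have hWle : ∀ d i jj, |W d i jj| ≤ 1 := fun d i jj ↦ by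
    have h1 := hq0 i (true, true)
    have h2 : q i (true, true) ≤ 1 := by linarith [(hq i (true, true)).2]
    rw [abs_div, abs_of_pos (hRpos d), div_le_one (hRpos d), hmeanq]
    refine le_trans ?_ (hv' i d)
    have hind : (capArr v i jj d : ℝ) = (if jj.1 ∧ jj.2 then 1 else 0) * (v i d : ℝ) := by
      unfold capArr; split_ifs <;> simp
    rw [hind, ← sub_mul, abs_mul]
    refine mul_le_of_le_one_left (abs_nonneg _) (abs_le.2 ?_)
    split_ifs <;> constructor <;> linarith
  have hW0 : ∀ d i, ∑ jj, q i jj * W d i jj = 0 := fun d i ↦ by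
    have h1 : ∀ jj, q i jj * W d i jj = (q i jj * (capArr v i jj d : ℝ) -
        q i jj * ∑ kk, q i kk * (capArr v i kk d : ℝ)) / R d := fun jj ↦ by
      simp only [W]; ring
    simp only [h1]
    rw [← sum_div, sum_sub_distrib, ← sum_mul, hq1]
    simp
  have hWsum : ∀ d (r : Fin n → Bool × Bool), ∑ i, W d i (r i) =
      ((arrEval (capArr v) r d : ℝ) - arrExp (capArr v) (prodMeas q) d) / R d := fun d r ↦ by
    rw [arrExp_prodMeas hq1]
    simp only [W, arrEval]
    rw [← sum_div, sum_sub_distrib]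
    push_cast
    rfl
  have hsplit := smeas_le_add_sum (prodMeas_nonneg hq0)
    (A := {r : Fin n → Bool × Bool | (fun i ↦ (r i).1) ∈ A ∧ (fun i ↦ (r i).2) ∈ A})
    (B := {r : Fin n → Bool × Bool | (fun i ↦ (r i).1) ∈ A ∧ (fun i ↦ (r i).2) ∈ A ∧
      rnorm (fun d ↦ (R d : ℝ))
        (fun d ↦ (arrEval (capArr v) r d : ℝ) - arrExp (capArr v) (prodMeas q) d) ≤ ζ * n})
    (S := fun s : Fin D ⊕ Fin D ↦ Sum.elim
      (fun d ↦ {r : Fin n → Bool × Bool | ζ * n < ∑ i, W d i (r i)})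
      (fun d ↦ {r : Fin n → Bool × Bool | ζ * n < ∑ i, -W d i (r i)}) s) (by
    rintro r ⟨h1, h2⟩
    by_cases h : rnorm (fun d ↦ (R d : ℝ))
        (fun d ↦ (arrEval (capArr v) r d : ℝ) - arrExp (capArr v) (prodMeas q) d) ≤ ζ * n
    · exact Or.inl ⟨h1, h2, h⟩
    · right
      rw [rnorm_le_iff (by positivity)] at h
      push Not at h
      obtain ⟨d, hd⟩ := h
      rw [← abs_of_pos (hRpos d), ← abs_div, ← hWsum, lt_abs,
        ← sum_neg_distrib] at hd
      exact hd.elim (fun h ↦ ⟨Sum.inl d, h⟩) fun h ↦ ⟨Sum.inr d, h⟩)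
  have htail : ∀ s : Fin D ⊕ Fin D, smeas (prodMeas q) (Sum.elim
      (fun d ↦ {r : Fin n → Bool × Bool | ζ * n < ∑ i, W d i (r i)})
      (fun d ↦ {r : Fin n → Bool × Bool | ζ * n < ∑ i, -W d i (r i)}) s) ≤ β ^ n := by
    have hexp : Real.exp (-(ζ ^ 2 / 4)) ^ n ≤ β ^ n :=
      pow_le_pow_left₀ (Real.exp_pos _).le hβζ n
    rintro (d | d)
    · exact (smeas_chernoff hq0 hq1 (hWle d) (hW0 d) hζ0 hζ1.le).trans hexp
    · refine (smeas_chernoff (W := fun i j ↦ -W d i j) hq0 hq1 (fun i j ↦ ?_) (fun i ↦ ?_)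
        hζ0 hζ1.le).trans hexp
      · rw [abs_neg]; exact hWle d i j
      · simp only [mul_neg, sum_neg_distrib, hW0, neg_zero]
  have hbad := sum_le_sum fun s (_ : s ∈ univ) ↦ htail s
  simp only [sum_const, card_univ, Fintype.card_sum, Fintype.card_fin, nsmul_eq_mul,
    Nat.cast_add] at hbad
  have hbase : ρ ≤ (1 - (1 - β) / 4) * ((1 - δ) ^ C * (1 - δ) ^ C) := by
    have h1 : 1 - 2 * C * δ ≤ (1 - δ) ^ C * (1 - δ) ^ C := by
      have := one_add_mul_le_pow (a := -δ) (by linarith) (C + C)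
      rw [← pow_add, sub_eq_add_neg 1 δ]
      push_cast at this
      linarith
    have h2 : 1 - (1 - β) / 4 ≤ (1 - δ) ^ C * (1 - δ) ^ C := by linarith
    have h3 := mul_le_mul_of_nonneg_left h2 (by linarith : 0 ≤ 1 - (1 - β) / 4)
    nlinarith only [h3, hρ, sq_nonneg (1 - β)]
  have hlow : ρ ^ n ≤ (1 - (1 - β) / 4) ^ n * (smeas (prodMeas p) A ^ C *
      smeas (prodMeas p) A ^ C) := by
    have h1 : ((1 - δ) ^ n) ^ C ≤ smeas (prodMeas p) A ^ C :=
      pow_le_pow_left₀ (pow_nonneg (by linarith) n) hA.le C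
    have h0 : 0 ≤ ((1 - δ) ^ n) ^ C := pow_nonneg (pow_nonneg (by linarith) n) C
    calc ρ ^ n ≤ ((1 - (1 - β) / 4) * ((1 - δ) ^ C * (1 - δ) ^ C)) ^ n :=
          pow_le_pow_left₀ (by linarith) hbase n
      _ = (1 - (1 - β) / 4) ^ n * (((1 - δ) ^ n) ^ C * ((1 - δ) ^ n) ^ C) := by
          rw [mul_pow, mul_pow, pow_right_comm]
      _ ≤ _ := mul_le_mul_of_nonneg_left (mul_le_mul h1 h1 h0 (h0.trans h1))
          (pow_nonneg (by linarith) n)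
  have hbig := hn₀ n hn
  rw [div_pow, lt_div_iff₀ (pow_pos hβ0 n)] at hbig
  have hεn : (1 - ε) ^ n ≤ β ^ n := pow_le_pow_left₀ (by linarith) hβε n
  linarith
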